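/- Let k be an algebraically closed field of characteristic coprime to 6, let C = {q = 0} be a plane quartic, and let ℓ = {u₀x + v₀y + w₀z = 0} be a hyperinflection line of C with hyperinflection point p = [a,b,c]. Then: H(q) vanishes at (u₀,v₀,w₀) and ∇H(q)(u₀,v₀,w₀) ≠ 0 (the harmonic quartic curve is smooth at [ℓ]); K(q) and all three of its first partial derivatives vanish at (u₀,v₀,w₀) (the harmonic sextic curve is singular at [ℓ]); and ∇H(q)(u₀,v₀,w₀) is proportional to (a,b,c), i.e. the tangent line to {H(q) = 0} at [ℓ] is the pencil of lines through p. -/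

import Mathlib

open MvPolynomial

noncomputable section

/-- The classical invariant `S` of a binary quartic form with coefficients `f 0, …, f 4`. -/
def Sinv {R : Type*} [CommRing R] (f : Fin 5 → R) : R :=
  12 * f 0 * f 4 - 3 * f 1 * f 3 + f 2 ^ 2

/-- The classical invariant `T` of a binary quartic form with coefficients `f 0, …, f 4`. -/
def Tinv {R : Type*} [CommRing R] (f : Fin 5 → R) : R :=
  72 * f 0 * f 2 * f 4 - 27 * f 0 * f 3 ^ 2 - 27 * f 1 ^ 2 * f 4
    + 9 * f 1 * f 2 * f 3 - 2 * f 2 ^ 3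

/-- The binary quartic form `f₀ y⁴ + f₁ y³z + f₂ y²z² + f₃ yz³ + f₄ z⁴`. -/
def binQuartic {R : Type*} [CommRing R] (f : Fin 5 → R) : MvPolynomial (Fin 2) R :=
  ∑ i : Fin 5, C (f i) * X 0 ^ (4 - (i : ℕ)) * X 1 ^ (i : ℕ)

/-- The `i`-th coefficient of a binary quartic form: coefficient of `y^(4-i) z^i`. -/
def binCoeff {R : Type*} [CommRing R] (g : MvPolynomial (Fin 2) R) (i : Fin 5) : R :=
  coeff (Finsupp.single 0 (4 - (i : ℕ)) + Finsupp.single 1 (i : ℕ)) g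

/-- The substitution `g(y,z) = q(-v·y - w·z, u·y, u·z)`, a binary quartic form in `y, z` with
coefficients in `R[u,v,w]`. -/
def gsub {R : Type*} [CommRing R] (q : MvPolynomial (Fin 3) R) :
    MvPolynomial (Fin 2) (MvPolynomial (Fin 3) R) :=
  aeval
    (![(C (- X 1) * X 0 - C (X 2) * X 1 : MvPolynomial (Fin 2) (MvPolynomial (Fin 3) R)),
       C (X 0) * X 0, C (X 0) * X 1]) q

/-- `u⁴ · H(q)`, the invariant `S` of `g(y,z) = q(-vy-wz, uy, uz)`; the harmonic quartic `H(q)`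
is the form determined by `u⁴ · H(q) = SG q`. -/
def SG {R : Type*} [CommRing R] (q : MvPolynomial (Fin 3) R) : MvPolynomial (Fin 3) R :=
  Sinv (fun i => binCoeff (gsub q) i)

/-- `u⁶ · K(q)`, the invariant `T` of `g(y,z) = q(-vy-wz, uy, uz)`; the harmonic sextic `K(q)`
is the form determined by `u⁶ · K(q) = TG q`. -/
def TG {R : Type*} [CommRing R] (q : MvPolynomial (Fin 3) R) : MvPolynomial (Fin 3) R :=
  Tinv (fun i => binCoeff (gsub q) i)

/-- dot product of two vectors in `R³`. -/
def dot3 {R : Type*} [CommRing R] (d a : Fin 3 → R) : R :=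
  d 0 * a 0 + d 1 * a 1 + d 2 * a 2

/-- restriction of a ternary form to the parameterized line `(y,z) ↦ y·a + z·b`. -/
def restrictLine {R : Type*} [CommRing R] (q : MvPolynomial (Fin 3) R) (a b : Fin 3 → R) :
    MvPolynomial (Fin 2) R :=
  aeval (fun i => C (a i) * X 0 + C (b i) * X 1) q

/-- A binary quartic form vanishes identically or has a root of multiplicity at least `3`:
`f = L³·M` with `L ≠ 0` linear and `M` linear (possibly zero). -/
def HasTripleRoot {R : Type*} [CommRing R] (f : MvPolynomial (Fin 2) R) : Prop :=
  ∃ L M : MvPolynomial (Fin 2) R,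
    L.IsHomogeneous 1 ∧ M.IsHomogeneous 1 ∧ L ≠ 0 ∧ f = L ^ 3 * M

/-- The line with dual coordinates `d` is an inflection line of the quartic `{q = 0}`. -/
def IsInflectionLine {k : Type*} [Field k] (q : MvPolynomial (Fin 3) k) (d : Fin 3 → k) :
    Prop :=
  d ≠ 0 ∧ ∃ a b : Fin 3 → k, LinearIndependent k ![a, b] ∧
    dot3 d a = 0 ∧ dot3 d b = 0 ∧ HasTripleRoot (restrictLine q a b)

/-- The line with dual coordinates `d` is a simple inflection line of `{q = 0}` with
inflection point `p`. -/
def IsSimpleInflectionLineAt {k : Type*} [Field k] (q : MvPolynomial (Fin 3) k)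
    (d p : Fin 3 → k) : Prop :=
  d ≠ 0 ∧ ∃ (a b : Fin 3 → k) (s t : k), LinearIndependent k ![a, b] ∧
    dot3 d a = 0 ∧ dot3 d b = 0 ∧ (s, t) ≠ (0, 0) ∧
    (∀ i, p i = s * a i + t * b i) ∧
    eval p q = 0 ∧ (∃ i, eval p (pderiv i q) ≠ 0) ∧
    ∃ L M : MvPolynomial (Fin 2) k, L.IsHomogeneous 1 ∧ M.IsHomogeneous 1 ∧
      LinearIndependent k ![L, M] ∧
      restrictLine q a b = L ^ 3 * M ∧ eval ![s, t] L = 0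

/-- The line with dual coordinates `d` is a hyperinflection line of `{q = 0}` with
hyperinflection point `p`. -/
def IsHyperinflectionLineAt {k : Type*} [Field k] (q : MvPolynomial (Fin 3) k)
    (d p : Fin 3 → k) : Prop :=
  d ≠ 0 ∧ ∃ (a b : Fin 3 → k) (s t : k), LinearIndependent k ![a, b] ∧
    dot3 d a = 0 ∧ dot3 d b = 0 ∧ (s, t) ≠ (0, 0) ∧
    (∀ i, p i = s * a i + t * b i) ∧
    eval p q = 0 ∧ (∃ i, eval p (pderiv i q) ≠ 0) ∧
    ∃ (c : k) (L : MvPolynomial (Fin 2) k), c ≠ 0 ∧ L.IsHomogeneous 1 ∧ L ≠ 0 ∧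
      restrictLine q a b = C c * L ^ 4 ∧ eval ![s, t] L = 0

/-- The pairing `⟨·,·⟩` between quartic forms in `x,y,z` and quartic forms in `u,v,w`:
`⟨x^i y^j z^k, u^i v^j w^k⟩ = i!j!k!/2`. -/
def pairQ {R : Type*} [CommRing R] (q h : MvPolynomial (Fin 3) R) : R :=
  ∑ m ∈ q.support,
    (((m 0).factorial * (m 1).factorial * (m 2).factorial / 2 : ℕ) : R)
      * coeff m q * coeff m h

/-- The action of `Σ c_{ξη} ξ ∂_η ∈ 𝔤𝔩₃(R)` on polynomials. -/
def lieAct {R : Type*} [CommRing R] (c : Fin 3 → Fin 3 → R)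
    (q : MvPolynomial (Fin 3) R) : MvPolynomial (Fin 3) R :=
  ∑ ξ : Fin 3, ∑ η : Fin 3, C (c ξ η) * (X ξ * pderiv η q)

/-- substitution of variables by the linear change of coordinates `M`: `q(M·(x,y,z)ᵗ)`. -/
def substM {R : Type*} [CommRing R] (M : Matrix (Fin 3) (Fin 3) R)
    (q : MvPolynomial (Fin 3) R) : MvPolynomial (Fin 3) R :=
  aeval (fun i => ∑ j : Fin 3, C (M i j) * X j) q

/-- The quartic form `q_ε = (x−y)⁴ + (x−z)⁴ + (y−εz)⁴ − (x⁴ + y⁴ + z⁴)`. -/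
def qeps {k : Type*} [CommRing k] (ε : k) : MvPolynomial (Fin 3) k :=
  (X 0 - X 1) ^ 4 + (X 0 - X 2) ^ 4 + (X 1 - C ε * X 2) ^ 4
    - (X 0 ^ 4 + X 1 ^ 4 + X 2 ^ 4)

theorem hf_binCoeff_binQuartic {R : Type*} [CommRing R] (f : Fin 5 → R) (i : Fin 5) :
    binCoeff (binQuartic f) i = f i := by
  unfold binCoeff binQuartic
  rw [coeff_sum, Finset.sum_eq_single i]
  · rw [mul_assoc, coeff_C_mul, X_pow_eq_monomial, X_pow_eq_monomial, monomial_mul, coeff_monomial]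
    simp
  · intro j _ hji
    rw [mul_assoc, coeff_C_mul, X_pow_eq_monomial, X_pow_eq_monomial, monomial_mul, coeff_monomial,
      if_neg, mul_zero]
    intro h
    apply hji
    have := DFunLike.congr_fun h 1
    simp at this
    exact Fin.ext this
  · simp

theorem hf_eq_binQuartic {R : Type*} [CommRing R] (g : MvPolynomial (Fin 2) R)
    (hg : g.IsHomogeneous 4) : g = binQuartic (binCoeff g) := by
  have hb : (binQuartic (binCoeff g)).IsHomogeneous 4 := by
    unfold binQuartic
    apply IsHomogeneous.sum
    intro i _
    have h1 := ((isHomogeneous_C (Fin 2) (binCoeff g i)).mul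
      (isHomogeneous_X_pow (R := R) (0 : Fin 2) (4 - (i : ℕ)))).mul
      (isHomogeneous_X_pow (R := R) (1 : Fin 2) (i : ℕ))
    convert h1 using 1
    omega
  ext m
  by_cases hm : m.degree = 4
  · have hm' : m 0 + m 1 = 4 := by
      simpa [Finsupp.degree_eq_sum] using hm
    have e : m = Finsupp.single 0 (4 - (m 1)) + Finsupp.single 1 (m 1) := by
      ext j
      fin_cases j
      · simp; omega
      · simp
    have := hf_binCoeff_binQuartic (binCoeff g) ⟨m 1, by omega⟩
    unfold binCoeff at this
    simp only [] at this
    rw [← e] at this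
    exact this.symm
  · rw [hg.coeff_eq_zero hm, hb.coeff_eq_zero hm]

/-- restriction to a line with coordinates in an algebra. -/
def hfR {k B : Type*} [CommRing k] [CommRing B] [Algebra k B] (q : MvPolynomial (Fin 3) k)
    (a b : Fin 3 → B) : MvPolynomial (Fin 2) B :=
  aeval (fun i => C (a i) * X 0 + C (b i) * X 1) q

theorem hfR_hom {k B : Type*} [CommRing k] [CommRing B] [Algebra k B]
    (q : MvPolynomial (Fin 3) k) (hq : q.IsHomogeneous 4)
    (a b : Fin 3 → B) : (hfR q a b).IsHomogeneous 4 := by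
  unfold hfR
  rw [aeval_def, eval₂_eq']
  apply IsHomogeneous.sum
  intro m hm
  have hm4 : m.degree = 4 := by
    by_contra h
    exact (mem_support_iff.mp hm) (hq.coeff_eq_zero h)
  have h1 : ((algebraMap k (MvPolynomial (Fin 2) B)) (coeff m q)).IsHomogeneous 0 := by
    rw [IsScalarTower.algebraMap_apply k B, algebraMap_eq]
    exact isHomogeneous_C _ _
  have h2 : (∏ i, (C (a i) * X 0 + C (b i) * X 1 : MvPolynomial (Fin 2) B) ^ m i).IsHomogeneous
      (∑ i, 1 * m i) := by
    apply IsHomogeneous.prod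
    intro i _
    apply IsHomogeneous.pow
    exact (isHomogeneous_C_mul_X _ _).add (isHomogeneous_C_mul_X _ _)
  convert h1.mul h2 using 1
  rw [← hm4, Finsupp.degree_eq_sum]
  simp

theorem hfR_map {k B B' : Type*} [CommRing k] [CommRing B] [Algebra k B] [CommRing B']
    [Algebra k B'] (φ : B →ₐ[k] B') (q : MvPolynomial (Fin 3) k) (a b : Fin 3 → B) :
    map (φ : B →+* B') (hfR q a b) = hfR q (fun i => φ (a i)) (fun i => φ (b i)) := by
  unfold hfR
  have : ((mapAlgHom φ).comp (aeval (fun i => C (a i) * X 0 + C (b i) * X 1 :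
      Fin 3 → MvPolynomial (Fin 2) B))) = aeval (fun i => C (φ (a i)) * X 0 + C (φ (b i)) * X 1 :
      Fin 3 → MvPolynomial (Fin 2) B') := by
    ext i
    simp
  exact DFunLike.congr_fun this q

theorem hfR_coeff_map {k B B' : Type*} [CommRing k] [CommRing B] [Algebra k B] [CommRing B']
    [Algebra k B'] (φ : B →ₐ[k] B') (q : MvPolynomial (Fin 3) k) (a b : Fin 3 → B) (i : Fin 5) :
    binCoeff (hfR q (fun i => φ (a i)) (fun i => φ (b i))) i = φ (binCoeff (hfR q a b) i) := by
  rw [← hfR_map]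
  unfold binCoeff
  rw [coeff_map]
  rfl

theorem hfR_change {k B : Type*} [CommRing k] [CommRing B] [Algebra k B]
    (q : MvPolynomial (Fin 3) k) (a b : Fin 3 → B) (α β γ δ : B) :
    hfR q (fun i => α * a i + β * b i) (fun i => γ * a i + δ * b i) =
      aeval ![C α * X 0 + C γ * X 1, (C β * X 0 + C δ * X 1 : MvPolynomial (Fin 2) B)]
        (hfR q a b) := by
  unfold hfR
  have : (aeval (fun i => C (α * a i + β * b i) * X 0 + C (γ * a i + δ * b i) * X 1 :
      Fin 3 → MvPolynomial (Fin 2) B) : MvPolynomial (Fin 3) k →ₐ[k] _) =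
      ((aeval ![C α * X 0 + C γ * X 1, (C β * X 0 + C δ * X 1 : MvPolynomial (Fin 2) B)] :
        MvPolynomial (Fin 2) B →ₐ[B] MvPolynomial (Fin 2) B).restrictScalars k).comp
      (aeval (fun i => C (a i) * X 0 + C (b i) * X 1 : Fin 3 → MvPolynomial (Fin 2) B)) := by
    ext1 i
    simp [bind₁_C_right, -algHom_C]
    ring
  exact DFunLike.congr_fun this q

/-- coefficients of a transformed quartic. -/
def hfT {B : Type*} [CommRing B] (f : Fin 5 → B) (α β γ δ : B) : Fin 5 → B :=
  ![f 0 * α^4 + f 1 * α^3 * β + f 2 * α^2 * β^2 + f 3 * α * β^3 + f 4 * β^4,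
    4 * f 0 * α^3 * γ + f 1 * (3 * α^2 * γ * β + α^3 * δ)
      + f 2 * (2 * α * γ * β^2 + 2 * α^2 * β * δ) + f 3 * (γ * β^3 + 3 * α * β^2 * δ)
      + 4 * f 4 * β^3 * δ,
    6 * f 0 * α^2 * γ^2 + f 1 * (3 * α * γ^2 * β + 3 * α^2 * γ * δ)
      + f 2 * (γ^2 * β^2 + 4 * α * γ * β * δ + α^2 * δ^2)
      + f 3 * (3 * γ * β^2 * δ + 3 * α * β * δ^2) + 6 * f 4 * β^2 * δ^2,
    4 * f 0 * α * γ^3 + f 1 * (γ^3 * β + 3 * α * γ^2 * δ)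
      + f 2 * (2 * γ^2 * β * δ + 2 * α * γ * δ^2) + f 3 * (3 * γ * β * δ^2 + α * δ^3)
      + 4 * f 4 * β * δ^3,
    f 0 * γ^4 + f 1 * γ^3 * δ + f 2 * γ^2 * δ^2 + f 3 * γ * δ^3 + f 4 * δ^4]

theorem hfT_spec {B : Type*} [CommRing B] (f : Fin 5 → B) (α β γ δ : B) :
    aeval ![C α * X 0 + C γ * X 1, (C β * X 0 + C δ * X 1 : MvPolynomial (Fin 2) B)]
        (binQuartic f) = binQuartic (hfT f α β γ δ) := by
  unfold binQuartic hfT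
  have c2 : (C (2 : B) : MvPolynomial (Fin 2) B) = 2 := map_ofNat C 2
  have c3 : (C (3 : B) : MvPolynomial (Fin 2) B) = 3 := map_ofNat C 3
  have c4 : (C (4 : B) : MvPolynomial (Fin 2) B) = 4 := map_ofNat C 4
  have c6 : (C (6 : B) : MvPolynomial (Fin 2) B) = 6 := map_ofNat C 6
  simp [Fin.sum_univ_five, bind₁_C_right, c2, c3, c4, c6, -algHom_C]
  ring

theorem hfT_S {B : Type*} [CommRing B] (f : Fin 5 → B) (α β γ δ : B) :
    Sinv (hfT f α β γ δ) = (α * δ - β * γ) ^ 4 * Sinv f := by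
  simp only [Sinv, hfT, Matrix.cons_val]
  ring

theorem hfT_T {B : Type*} [CommRing B] (f : Fin 5 → B) (α β γ δ : B) :
    Tinv (hfT f α β γ δ) = (α * δ - β * γ) ^ 6 * Tinv f := by
  simp only [Tinv, hfT, Matrix.cons_val]
  ring

/-- cross product. -/
def hfX {B : Type*} [CommRing B] (a b : Fin 3 → B) : Fin 3 → B :=
  ![a 1 * b 2 - a 2 * b 1, a 2 * b 0 - a 0 * b 2, a 0 * b 1 - a 1 * b 0]

theorem hfR_change_coeff {k B : Type*} [CommRing k] [CommRing B] [Algebra k B]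
    (q : MvPolynomial (Fin 3) k) (hq : q.IsHomogeneous 4) (a b : Fin 3 → B) (α β γ δ : B) :
    binCoeff (hfR q (fun i => α * a i + β * b i) (fun i => γ * a i + δ * b i)) =
      hfT (binCoeff (hfR q a b)) α β γ δ := by
  rw [hfR_change]
  conv_lhs => rw [hf_eq_binQuartic _ (hfR_hom q hq a b)]
  rw [hfT_spec]
  funext i
  exact hf_binCoeff_binQuartic _ i

theorem hf_gsub {k B : Type*} [CommRing k] [CommRing B] [Algebra k B]
    (q : MvPolynomial (Fin 3) k) (hq : q.IsHomogeneous 4) (a b : Fin 3 → B) (i : Fin 5) :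
    aeval (hfX a b) (binCoeff (gsub q) i) =
      hfT (binCoeff (hfR q a b)) (b 2) (- a 2) (- b 1) (a 1) i := by
  have h : gsub q = hfR q (B := MvPolynomial (Fin 3) k) ![-X 1, X 0, 0] ![-X 2, 0, X 0] := by
    unfold gsub hfR
    congr 2
    funext j
    fin_cases j <;> simp [sub_eq_add_neg] <;> ring
  rw [h, ← hfR_coeff_map, ← hfR_change_coeff q hq]
  congr 2
  · funext j
    fin_cases j <;> simp [hfX] <;> ring
  · funext j
    fin_cases j <;> simp [hfX] <;> ring

theorem hf_univ0 {k B : Type*} [CommRing k] [CommRing B] [IsDomain B] [Algebra k B]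
    (q : MvPolynomial (Fin 3) k) (hq : q.IsHomogeneous 4) (H K : MvPolynomial (Fin 3) k)
    (hH : X 0 ^ 4 * H = SG q) (hK : X 0 ^ 6 * K = TG q) (a b : Fin 3 → B)
    (h0 : hfX a b 0 ≠ 0) :
    aeval (hfX a b) H = Sinv (binCoeff (hfR q a b)) ∧
    aeval (hfX a b) K = Tinv (binCoeff (hfR q a b)) := by
  have hdet : b 2 * a 1 - (- a 2) * (- b 1) = hfX a b 0 := by
    simp [hfX]; ring
  constructor
  · apply mul_left_cancel₀ (pow_ne_zero 4 h0)
    have h1 := congrArg (aeval (hfX a b)) hH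
    rw [map_mul, map_pow, aeval_X] at h1
    rw [h1, ← hdet, ← hfT_S]
    simp only [SG, Sinv, map_add, map_sub, map_mul, map_pow, hf_gsub q hq, map_ofNat]
  · apply mul_left_cancel₀ (pow_ne_zero 6 h0)
    have h1 := congrArg (aeval (hfX a b)) hK
    rw [map_mul, map_pow, aeval_X] at h1
    rw [h1, ← hdet, ← hfT_T]
    simp only [TG, Tinv, map_add, map_sub, map_mul, map_pow, hf_gsub q hq, map_ofNat]

theorem hf_univ {k B : Type*} [Field k] [CommRing B] [Algebra k B]
    (q : MvPolynomial (Fin 3) k) (hq : q.IsHomogeneous 4) (H K : MvPolynomial (Fin 3) k)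
    (hH : X 0 ^ 4 * H = SG q) (hK : X 0 ^ 6 * K = TG q) (a b : Fin 3 → B) :
    aeval (hfX a b) H = Sinv (binCoeff (hfR q a b)) ∧
    aeval (hfX a b) K = Tinv (binCoeff (hfR q a b)) := by
  let a0 : Fin 3 → MvPolynomial (Fin 3 ⊕ Fin 3) k := fun i => X (Sum.inl i)
  let b0 : Fin 3 → MvPolynomial (Fin 3 ⊕ Fin 3) k := fun i => X (Sum.inr i)
  have h0 : hfX a0 b0 0 ≠ 0 := by
    intro h
    have := congrArg (eval (Sum.elim ![0, 1, 0] ![0, 0, (1 : k)])) h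
    simp [hfX, a0, b0] at this
  obtain ⟨h1, h2⟩ := hf_univ0 q hq H K hH hK a0 b0 h0
  let φ : MvPolynomial (Fin 3 ⊕ Fin 3) k →ₐ[k] B := aeval (Sum.elim a b)
  have ea : (fun i => φ (a0 i)) = a := by funext i; simp [φ, a0]
  have eb : (fun i => φ (b0 i)) = b := by funext i; simp [φ, b0]
  have ex : (fun i => φ (hfX a0 b0 i)) = hfX a b := by
    funext i
    fin_cases i <;> simp [hfX, φ, a0, b0]
  have hc : ∀ i, binCoeff (hfR q a b) i = φ (binCoeff (hfR q a0 b0) i) := by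
    intro i
    rw [← hfR_coeff_map, ea, eb]
  have hp : ∀ P : MvPolynomial (Fin 3) k, aeval (hfX a b) P = φ (aeval (hfX a0 b0) P) := by
    intro P
    rw [← ex, ← AlgHom.comp_apply, comp_aeval]
  rw [hp, hp, h1, h2]
  simp only [Sinv, Tinv, map_add, map_sub, map_mul, map_pow, hc, map_ofNat, and_self]

theorem hf_dual {k : Type*} [Field k] (P : MvPolynomial (Fin 3) k) (x e : Fin 3 → k) :
    (aeval (fun i => (TrivSqZeroExt.inl (x i) + TrivSqZeroExt.inr (e i) : DualNumber k)) P).fst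
      = eval x P ∧
    (aeval (fun i => (TrivSqZeroExt.inl (x i) + TrivSqZeroExt.inr (e i) : DualNumber k)) P).snd
      = ∑ i, eval x (pderiv i P) * e i := by
  induction P using MvPolynomial.induction_on with
  | C r => simp [TrivSqZeroExt.algebraMap_eq_inl]
  | add f g hf hg =>
    simp only [map_add, TrivSqZeroExt.fst_add, TrivSqZeroExt.snd_add, hf.1, hf.2, hg.1, hg.2,
      Finset.sum_add_distrib, add_mul, and_self]
  | mul_X f j hf =>
    refine ⟨by rw [map_mul, TrivSqZeroExt.fst_mul, hf.1]; simp, ?_⟩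
    simp only [map_mul, aeval_X, TrivSqZeroExt.snd_mul, hf.1, hf.2, Derivation.leibniz, pderiv_X]
    simp [Fin.sum_univ_three]
    fin_cases j <;> simp <;> ring

theorem hf_parallel {k : Type*} [Field k] (G p : Fin 3 → k) (hp : p ≠ 0)
    (h : ∀ e : Fin 3 → k, ∑ i, G i * hfX p e i = 0) : ∃ g, ∀ i, G i = g * p i := by
  have h0 := h ![1, 0, 0]
  have h1 := h ![0, 1, 0]
  have h2 := h ![0, 0, 1]
  simp [hfX, Fin.sum_univ_three] at h0 h1 h2
  obtain ⟨i, hi⟩ := Function.ne_iff.mp hp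
  simp only [Pi.zero_apply] at hi
  refine ⟨G i / p i, fun j => ?_⟩
  field_simp
  fin_cases i <;> fin_cases j <;> simp <;>
    first
    | done
    | linear_combination h0
    | linear_combination -h0
    | linear_combination h1
    | linear_combination -h1
    | linear_combination h2
    | linear_combination -h2

theorem hf_cross {k : Type*} [Field k] (d a b : Fin 3 → k) (hd : d ≠ 0)
    (hab : LinearIndependent k ![a, b]) (ha : dot3 d a = 0) (hb : dot3 d b = 0) :
    ∃ r : k, r ≠ 0 ∧ ∀ i, d i = r * hfX a b i := by
  have hn : hfX a b ≠ 0 := by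
    have := crossProduct_ne_zero_iff_linearIndependent.mpr hab
    rwa [cross_apply] at this
  unfold dot3 at ha hb
  obtain ⟨g, hg⟩ := hf_parallel d (hfX a b) hn (by
    intro e
    simp [hfX, Fin.sum_univ_three]
    linear_combination -(b 0 * e 0 + b 1 * e 1 + b 2 * e 2) * ha
      + (a 0 * e 0 + a 1 * e 1 + a 2 * e 2) * hb)
  refine ⟨g, ?_, hg⟩
  rintro rfl
  apply hd
  funext i
  simp [hg i]

theorem hf_linear {k : Type*} [Field k] (L : MvPolynomial (Fin 2) k) (hL : L.IsHomogeneous 1) :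
    ∃ l m : k, L = C l * X 0 + C m * X 1 := by
  refine ⟨coeff (Finsupp.single 0 1) L, coeff (Finsupp.single 1 1) L, ?_⟩
  ext e
  by_cases he : e.degree = 1
  · have he' : e 0 + e 1 = 1 := by
      simpa [Finsupp.degree_eq_sum] using he
    have : e = Finsupp.single 0 1 ∨ e = Finsupp.single 1 1 := by
      rcases Nat.eq_zero_or_pos (e 0) with h | h
      · right
        ext j
        fin_cases j <;> simp <;> omega
      · left
        ext j
        fin_cases j <;> simp <;> omega
    rcases this with rfl | rfl <;> simp [coeff_X, Finsupp.single_left_inj]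
  · rw [hL.coeff_eq_zero he]
    exact (((isHomogeneous_C_mul_X _ _).add (isHomogeneous_C_mul_X _ _)).coeff_eq_zero he).symm

/-- normalisation of the basis of the line. -/
theorem hf_normal {k : Type*} [Field k] (q : MvPolynomial (Fin 3) k)
    (d p : Fin 3 → k) (hd : IsHyperinflectionLineAt q d p) :
    ∃ (b : Fin 3 → k) (c : k), c ≠ 0 ∧ hfX p b = d ∧
      binCoeff (hfR q p b) = ![0, 0, 0, 0, c] := by
  obtain ⟨hd0, a, b, s, t, hab, ha, hb, hst, hp, -, -, c, L, hc, hL, hL0, hres, hev⟩ := hd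
  obtain ⟨r, hr, hdr⟩ := hf_cross d a b hd0 hab ha hb
  obtain ⟨l, m, rfl⟩ := hf_linear L hL
  simp at hev
  obtain ⟨μ, ν, hμν⟩ : ∃ μ ν : k, s * ν - t * μ = r := by
    by_cases hs : s = 0
    · have ht : t ≠ 0 := by
        rintro rfl
        exact hst (by rw [hs])
      exact ⟨-r / t, 0, by field_simp; ring⟩
    · exact ⟨0, r / s, by field_simp; ring⟩
  have hlin : l * μ + m * ν ≠ 0 := by
    intro h
    apply hL0
    have h1 : l = 0 := by
      have : r * l = 0 := by rw [← hμν]; linear_combination ν * hev - t * h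
      simpa [hr] using this
    have h2 : m = 0 := by
      have : r * m = 0 := by rw [← hμν]; linear_combination s * h - μ * hev
      simpa [hr] using this
    simp [h1, h2]
  have hpe : p = fun i => s * a i + t * b i := funext hp
  refine ⟨fun i => μ * a i + ν * b i, c * (l * μ + m * ν) ^ 4, mul_ne_zero hc (pow_ne_zero 4 hlin), ?_, ?_⟩
  · funext i
    rw [hdr, ← hμν, hpe]
    fin_cases i <;> simp [hfX] <;> ring
  · have hR : hfR q a b = C c * (C l * X 0 + C m * X 1) ^ 4 := hres
    rw [hpe, hfR_change, hR]
    have : aeval ![C s * X 0 + C μ * X 1, (C t * X 0 + C ν * X 1 : MvPolynomial (Fin 2) k)]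
        (C c * (C l * X 0 + C m * X 1) ^ 4 : MvPolynomial (Fin 2) k) =
        binQuartic ![0, 0, 0, 0, c * (l * μ + m * ν) ^ 4] := by
      have h0 : (C l * C s + C m * C t : MvPolynomial (Fin 2) k) = 0 := by
        rw [← C_mul, ← C_mul, ← C_add, hev, C_0]
      have h1 : aeval ![C s * X 0 + C μ * X 1, (C t * X 0 + C ν * X 1 : MvPolynomial (Fin 2) k)]
          (C l * X 0 + C m * X 1 : MvPolynomial (Fin 2) k) = C (l * μ + m * ν) * X 1 := by
        simp [bind₁_C_right, -algHom_C]
        linear_combination X 0 * h0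
      rw [map_mul, map_pow, h1]
      simp [binQuartic, Fin.sum_univ_five, bind₁_C_right, -algHom_C]
      ring
    rw [this]
    funext i
    exact hf_binCoeff_binQuartic _ i


theorem hf_binCoeff_zero {B : Type*} [CommRing B] (g : MvPolynomial (Fin 2) B)
    (hg : g.IsHomogeneous 4) : binCoeff g 0 = aeval ![(1 : B), 0] g := by
  conv_rhs => rw [hf_eq_binQuartic g hg]
  simp [binQuartic, Fin.sum_univ_five]

theorem hf_f0 {k B : Type*} [CommRing k] [CommRing B] [Algebra k B]
    (q : MvPolynomial (Fin 3) k) (hq : q.IsHomogeneous 4) (a b : Fin 3 → B) :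
    binCoeff (hfR q a b) 0 = aeval a q := by
  rw [hf_binCoeff_zero _ (hfR_hom q hq a b)]
  unfold hfR
  have : ((aeval ![(1 : B), 0] : MvPolynomial (Fin 2) B →ₐ[B] B).restrictScalars k).comp
      (aeval (fun i => C (a i) * X 0 + C (b i) * X 1 : Fin 3 → MvPolynomial (Fin 2) B)) =
      aeval a := by
    ext1 i
    simp
  exact DFunLike.congr_fun this q

theorem hf_sq {k : Type*} [Field k] (x y : DualNumber k) (hx : x.fst = 0) (hy : y.fst = 0) :
    x * y = 0 := by
  ext <;> simp [hx, hy]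

/-- The first order expansion. -/
theorem hf_main {k : Type*} [Field k] (q : MvPolynomial (Fin 3) k) (hq : q.IsHomogeneous 4)
    (H K : MvPolynomial (Fin 3) k)
    (hH : X 0 ^ 4 * H = SG q) (hK : X 0 ^ 6 * K = TG q) (p b : Fin 3 → k) (c : k)
    (hf : binCoeff (hfR q p b) = ![0, 0, 0, 0, c]) (a' b' : Fin 3 → k) :
    eval (hfX p b) H = 0 ∧ eval (hfX p b) K = 0 ∧
    ∑ i, eval (hfX p b) (pderiv i H) * (hfX a' b i + hfX p b' i)
      = 12 * c * ∑ i, eval p (pderiv i q) * a' i ∧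
    ∑ i, eval (hfX p b) (pderiv i K) * (hfX a' b i + hfX p b' i) = 0 := by
  let A : Fin 3 → DualNumber k := fun i => TrivSqZeroExt.inl (p i) + TrivSqZeroExt.inr (a' i)
  let B : Fin 3 → DualNumber k := fun i => TrivSqZeroExt.inl (b i) + TrivSqZeroExt.inr (b' i)
  have hX : hfX A B = fun i => (TrivSqZeroExt.inl (hfX p b i) +
      TrivSqZeroExt.inr (hfX a' b i + hfX p b' i) : DualNumber k) := by
    funext i
    fin_cases i <;> ext <;> simp [hfX, A, B] <;> ring
  obtain ⟨h1, h2⟩ := hf_univ q hq H K hH hK A B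
  rw [hX] at h1 h2
  have dH := hf_dual H (hfX p b) (fun i => hfX a' b i + hfX p b' i)
  have dK := hf_dual K (hfX p b) (fun i => hfX a' b i + hfX p b' i)
  rw [h1] at dH
  rw [h2] at dK
  have dq := hf_dual q p a'
  have e0 : binCoeff (hfR q A B) 0 = aeval A q := hf_f0 q hq A B
  rw [← e0] at dq
  have hfst : ∀ i, (binCoeff (hfR q A B) i).fst = (![0, 0, 0, 0, c] : Fin 5 → k) i := by
    intro i
    have := hfR_coeff_map (TrivSqZeroExt.fstHom k k k) q A B i
    rw [← hf]
    have eA : (fun i => TrivSqZeroExt.fstHom k k k (A i)) = p := by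
      funext i; simp [A]
    have eB : (fun i => TrivSqZeroExt.fstHom k k k (B i)) = b := by
      funext i; simp [B]
    rw [eA, eB] at this
    rw [this]
    rfl
  generalize binCoeff (hfR q A B) = f at *
  have f0 : (f 0).fst = 0 := hfst 0
  have f1 : (f 1).fst = 0 := hfst 1
  have f2 : (f 2).fst = 0 := hfst 2
  have f3 : (f 3).fst = 0 := hfst 3
  have f4 : (f 4).fst = c := hfst 4
  have hS : Sinv f = 12 * (f 0 * f 4) := by
    unfold Sinv
    linear_combination -3 * hf_sq _ _ f1 f3 + hf_sq _ _ f2 f2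
  have hT : Tinv f = 0 := by
    unfold Tinv
    linear_combination 72 * f 4 * hf_sq _ _ f0 f2 - 27 * f 3 * hf_sq _ _ f0 f3
      - 27 * f 4 * hf_sq _ _ f1 f1 + 9 * f 3 * hf_sq _ _ f1 f2 - 2 * f 2 * hf_sq _ _ f2 f2
  rw [hS] at dH
  rw [hT] at dK
  have t1 : ((12 : DualNumber k)).fst = 12 := rfl
  have t2 : ((12 : DualNumber k)).snd = 0 := rfl
  refine ⟨?_, ?_, ?_, ?_⟩
  · rw [← dH.1]; simp [f0]
  · rw [← dK.1]; simp
  · rw [← dH.2, ← dq.2]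
    simp [f0, f4, t1, t2]
    ring
  · rw [← dK.2]; simp

/-- If `ℓ` (with dual coordinates `d`) is a hyperinflection line of a plane
quartic `{q = 0}` with hyperinflection point `p`, over an algebraically closed field of
characteristic coprime to `6`, then the harmonic quartic is smooth at `d`, the harmonic
sextic is singular at `d`, and the gradient of the harmonic quartic at `d` is proportional
to `p` (the tangent line to `{H = 0}` at `[ℓ]` is the pencil of lines through `p`). -/
theorem stmt9 {k : Type*} [Field k] [IsAlgClosed k] (h6 : (6 : k) ≠ 0)
    (q : MvPolynomial (Fin 3) k) (hq0 : q ≠ 0) (hq4 : q.IsHomogeneous 4)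
    (d p : Fin 3 → k) (hd : IsHyperinflectionLineAt q d p)
    (H K : MvPolynomial (Fin 3) k)
    (hH : X 0 ^ 4 * H = SG q) (hK : X 0 ^ 6 * K = TG q) :
    eval d H = 0 ∧ (∃ i, eval d (pderiv i H) ≠ 0) ∧
      eval d K = 0 ∧ (∀ i, eval d (pderiv i K) = 0) ∧
      ∃ c : k, c ≠ 0 ∧ ∀ i, eval d (pderiv i H) = c * p i := by
  have hd0 : d ≠ 0 := hd.1
  obtain ⟨j, hj⟩ : ∃ i, eval p (pderiv i q) ≠ 0 := by
    obtain ⟨-, a, b, s, t, -, -, -, -, -, -, h, -⟩ := hd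
    exact h
  obtain ⟨b, c, hc, hX, hf⟩ := hf_normal q d p hd
  have main := hf_main q hq4 H K hH hK p b c hf
  rw [hX] at main
  have hp0 : p ≠ 0 := by
    rintro rfl
    apply hd0
    rw [← hX]
    funext i
    fin_cases i <;> simp [hfX]
  have z1 : ∀ (x : Fin 3 → k) i, hfX 0 x i = 0 := by
    intro x i
    fin_cases i <;> simp [hfX]
  have z2 : ∀ (x : Fin 3 → k) i, hfX x 0 i = 0 := by
    intro x i
    fin_cases i <;> simp [hfX]
  obtain ⟨g, hg⟩ := hf_parallel (fun i => eval d (pderiv i H)) p hp0 (by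
    intro e
    have := (main 0 e).2.2.1
    simpa [z1] using this)
  obtain ⟨g', hg'⟩ := hf_parallel (fun i => eval d (pderiv i K)) p hp0 (by
    intro e
    have := (main 0 e).2.2.2
    simpa [z1] using this)
  have h12 : (12 : k) ≠ 0 := by
    intro h
    apply h6
    have : (6 : k) * 6 = 0 := by linear_combination 3 * h
    simpa using this
  have hg0 : g ≠ 0 := by
    rintro rfl
    have := (main (Pi.single j 1) 0).2.2.1
    simp only [hg, z2, add_zero, zero_mul, Finset.sum_const_zero] at this
    simp [Pi.single_apply, h12, hc, hj] at this
  have hg'0 : g' = 0 := by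
    obtain ⟨i, hi⟩ := Function.ne_iff.mp hd0
    have h := (main (Pi.single i 1) 0).2.2.2
    simp only [hg', z2, add_zero] at h
    rw [← hX] at hi
    have : g' * hfX p b i = 0 := by
      rw [← neg_eq_zero, ← h]
      fin_cases i <;> simp [hfX, Fin.sum_univ_three] <;> ring
    exact (mul_eq_zero.mp this).resolve_right hi
  obtain ⟨i, hi⟩ := Function.ne_iff.mp hp0
  refine ⟨(main 0 0).1, ⟨i, ?_⟩, (main 0 0).2.1, fun i => ?_, g, hg0, hg⟩
  · rw [hg i]
    exact mul_ne_zero hg0 hi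
  · rw [hg' i, hg'0, zero_mul]
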